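/- Let (Γ, d) be a π-graded first order differential calculus over A that is both left and right covariant, and let Δ^l, Δ^r be the associated families of maps, i.e. Δ^l_{α,β}(Σ_k a_k·d_{αβ}(b_k)) = Σ_k Δ_{α,β}(a_k)·(id ⊗ d_β)(Δ_{α,β}(b_k)) and Δ^r_{α,β}(Σ_k a_k·d_{αβ}(b_k)) = Σ_k Δ_{α,β}(a_k)·(d_α ⊗ id)(Δ_{α,β}(b_k)). Then for all α, β, γ ∈ π, (id ⊗ Δ^r_{β,γ}) ∘ Δ^l_{α,βγ} = (Δ^l_{α,β} ⊗ id) ∘ Δ^r_{αβ,γ} as maps Γ_{αβγ} → A_α ⊗ Γ_β ⊗ A_γ. -/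

import Mathlib

open TensorProduct

/-- The componentwise action of `R ⊗[k] S` on `M ⊗[k] N` induced by `k`-bilinear
actions `f` of `R` on `M` and `g` of `S` on `N`: `(r ⊗ s) • (m ⊗ n) = (f r m) ⊗ (g s n)`. -/
noncomputable def tact {k : Type} [Field k] {R S M N : Type}
    [AddCommGroup R] [Module k R] [AddCommGroup S] [Module k S]
    [AddCommGroup M] [Module k M] [AddCommGroup N] [Module k N]
    (f : R →ₗ[k] M →ₗ[k] M) (g : S →ₗ[k] N →ₗ[k] N) :
    R ⊗[k] S →ₗ[k] (M ⊗[k] N) →ₗ[k] M ⊗[k] N :=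
  TensorProduct.lift (LinearMap.mk₂ k (fun r s => TensorProduct.map (f r) (g s))
    (fun r r' s => by simp only [map_add, TensorProduct.map_add_left])
    (fun c r s => by simp only [map_smul, TensorProduct.map_smul_left])
    (fun r s s' => by simp only [map_add, TensorProduct.map_add_right])
    (fun r c s => by simp only [map_smul, TensorProduct.map_smul_right]))

section

variable {k : Type} [Field k]

theorem tact_tmul {R S M N : Type}
    [AddCommGroup R] [Module k R] [AddCommGroup S] [Module k S]
    [AddCommGroup M] [Module k M] [AddCommGroup N] [Module k N]
    (f : R →ₗ[k] M →ₗ[k] M) (g : S →ₗ[k] N →ₗ[k] N) (r : R) (s : S) (m : M) (n : N) :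
    tact f g (r ⊗ₜ s) (m ⊗ₜ n) = f r m ⊗ₜ g s n := by
  simp [tact]

variable {P Q R B C : Type} [Ring P] [Algebra k P] [Ring Q] [Algebra k Q] [Ring R] [Algebra k R]
  [Ring B] [Algebra k B] [Ring C] [Algebra k C]
  {M N : Type} [AddCommGroup M] [Module k M] [AddCommGroup N] [Module k N]

theorem assoc_tact_tmul (s : Q →ₗ[k] M →ₗ[k] M) (d : Q →ₗ[k] M)
    (X Y : P ⊗[k] Q) (r r' : R) :
    TensorProduct.assoc k P M R
        (tact (LinearMap.mul k P) s X (LinearMap.lTensor P d Y) ⊗ₜ[k] (r * r'))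
      = tact (LinearMap.mul k P) (tact s (LinearMap.mul k R))
          (TensorProduct.assoc k P Q R (X ⊗ₜ r))
          (LinearMap.lTensor P (LinearMap.rTensor R d)
            (TensorProduct.assoc k P Q R (Y ⊗ₜ r'))) := by
  induction X with
  | zero => simp
  | add X X' h h' => simp only [map_add, LinearMap.add_apply, add_tmul, h, h']
  | tmul p q =>
    induction Y with
    | zero => simp
    | add Y Y' h h' => simp only [map_add, add_tmul, h, h']
    | tmul p' q' => simp [tact_tmul]

/-- Applying a left coaction to the first factor of `X · (d ⊗ id) Y`. -/
theorem assoc_rTensor_tact (Δ : B →ₐ[k] P ⊗[k] Q)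
    (sB : B →ₗ[k] N →ₗ[k] N) (dB : B →ₗ[k] N) (s : Q →ₗ[k] M →ₗ[k] M) (d : Q →ₗ[k] M)
    (D : N →ₗ[k] P ⊗[k] M)
    (hD : ∀ a b, D (sB a (dB b)) =
      tact (LinearMap.mul k P) s (Δ a) (LinearMap.lTensor P d (Δ b)))
    (X Y : B ⊗[k] R) :
    TensorProduct.assoc k P M R (LinearMap.rTensor R D
        (tact sB (LinearMap.mul k R) X (LinearMap.rTensor R dB Y)))
      = tact (LinearMap.mul k P) (tact s (LinearMap.mul k R))
          (TensorProduct.assoc k P Q R (Algebra.TensorProduct.map Δ (AlgHom.id k R) X))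
          (LinearMap.lTensor P (LinearMap.rTensor R d)
            (TensorProduct.assoc k P Q R
              (Algebra.TensorProduct.map Δ (AlgHom.id k R) Y))) := by
  induction X with
  | zero => simp
  | add X X' h h' => simp only [map_add, LinearMap.add_apply, h, h']
  | tmul x r =>
    induction Y with
    | zero => simp
    | add Y Y' h h' => simp only [map_add, h, h']
    | tmul y r' =>
      simp only [LinearMap.rTensor_tmul, tact_tmul, hD, LinearMap.mul_apply',
        assoc_tact_tmul, Algebra.TensorProduct.map_tmul, AlgHom.coe_id, id_eq]

/-- Applying a right coaction to the second factor of `X · (id ⊗ d) Y`. -/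
theorem lTensor_tact (Δ : C →ₐ[k] Q ⊗[k] R)
    (sC : C →ₗ[k] N →ₗ[k] N) (dC : C →ₗ[k] N) (s : Q →ₗ[k] M →ₗ[k] M) (d : Q →ₗ[k] M)
    (D : N →ₗ[k] M ⊗[k] R)
    (hD : ∀ a b, D (sC a (dC b)) =
      tact s (LinearMap.mul k R) (Δ a) (LinearMap.rTensor R d (Δ b)))
    (X Y : P ⊗[k] C) :
    LinearMap.lTensor P D (tact (LinearMap.mul k P) sC X (LinearMap.lTensor P dC Y))
      = tact (LinearMap.mul k P) (tact s (LinearMap.mul k R))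
          (Algebra.TensorProduct.map (AlgHom.id k P) Δ X)
          (LinearMap.lTensor P (LinearMap.rTensor R d)
            (Algebra.TensorProduct.map (AlgHom.id k P) Δ Y)) := by
  induction X with
  | zero => simp
  | add X X' h h' => simp only [map_add, LinearMap.add_apply, h, h']
  | tmul p x =>
    induction Y with
    | zero => simp
    | add Y Y' h h' => simp only [map_add, h, h']
    | tmul p' y =>
      simp only [LinearMap.lTensor_tmul, tact_tmul, hD, LinearMap.mul_apply',
        Algebra.TensorProduct.map_tmul, AlgHom.coe_id, id_eq]

end

/-- For a bicovariant `π`-graded first order differential calculus `(Γ, d)`,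
the associated left and right coactions `Δˡ`, `Δʳ` (characterized by
`Δˡ(a·d b) = Δ(a)·(id ⊗ d)(Δ b)` and `Δʳ(a·d b) = Δ(a)·(d ⊗ id)(Δ b)`) satisfy
`(id ⊗ Δʳ_{β,γ}) ∘ Δˡ_{α,βγ} = (Δˡ_{α,β} ⊗ id) ∘ Δʳ_{αβ,γ}`. -/
theorem bicovariant_fodc_coactions_commute
    {k : Type} [Field k] {G : Type} [Group G]
    (A : G → Type) [∀ α, Ring (A α)] [∀ α, Algebra k (A α)]
    (Δ : ∀ α β γ : G, α * β = γ → (A γ →ₐ[k] A α ⊗[k] A β))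
    (ε : A 1 →ₐ[k] k)
    (S : ∀ α β : G, α⁻¹ = β → (A α →ₗ[k] A β))
    (hcoassoc : ∀ (α β γ : G) (x : A (α * β * γ)),
      (TensorProduct.assoc k (A α) (A β) (A γ))
          ((Algebra.TensorProduct.map (Δ α β (α * β) rfl) (AlgHom.id k (A γ)))
            ((Δ (α * β) γ (α * β * γ) rfl) x))
        = (Algebra.TensorProduct.map (AlgHom.id k (A α)) (Δ β γ (β * γ) rfl))
            ((Δ α (β * γ) (α * β * γ) (mul_assoc α β γ).symm) x))
    (hcounit₁ : ∀ (α : G) (x : A α),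
      (TensorProduct.rid k (A α)) ((LinearMap.lTensor (A α) ε.toLinearMap)
        ((Δ α 1 α (mul_one α)) x)) = x)
    (hcounit₂ : ∀ (α : G) (x : A α),
      (TensorProduct.lid k (A α)) ((LinearMap.rTensor (A α) ε.toLinearMap)
        ((Δ 1 α α (one_mul α)) x)) = x)
    (hantipode₁ : ∀ (α : G) (x : A 1),
      (LinearMap.mul' k (A α)) ((LinearMap.rTensor (A α) (S α⁻¹ α (inv_inv α)))
        ((Δ α⁻¹ α 1 (inv_mul_cancel α)) x)) = ε x • 1)
    (hantipode₂ : ∀ (α : G) (x : A 1),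
      (LinearMap.mul' k (A α)) ((LinearMap.lTensor (A α) (S α⁻¹ α (inv_inv α)))
        ((Δ α α⁻¹ 1 (mul_inv_cancel α)) x)) = ε x • 1)
    (Γ : G → Type) [∀ α, AddCommGroup (Γ α)] [∀ α, Module k (Γ α)]
    (sl sr : ∀ α, A α →ₗ[k] Γ α →ₗ[k] Γ α)
    (hsl_one : ∀ (α : G) (x : Γ α), sl α 1 x = x)
    (hsl_mul : ∀ (α : G) (a b : A α) (x : Γ α), sl α (a * b) x = sl α a (sl α b x))
    (hsr_one : ∀ (α : G) (x : Γ α), sr α 1 x = x)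
    (hsr_mul : ∀ (α : G) (a b : A α) (x : Γ α), sr α (a * b) x = sr α b (sr α a x))
    (hslr : ∀ (α : G) (a b : A α) (x : Γ α), sl α a (sr α b x) = sr α b (sl α a x))
    (d : ∀ α, A α →ₗ[k] Γ α)
    (hLeibniz : ∀ (α : G) (a b : A α), d α (a * b) = sr α b (d α a) + sl α a (d α b))
    (hgen : ∀ (α : G) (x : Γ α),
      x ∈ Submodule.span k {y : Γ α | ∃ a b : A α, y = sl α a (d α b)})
    (hlcov : ∀ (α β : G) (n : ℕ) (a b : Fin n → A (α * β)),
      (∑ i, sl (α * β) (a i) (d (α * β) (b i))) = 0 →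
      (∑ i, tact (LinearMap.mul k (A α)) (sl β) ((Δ α β (α * β) rfl) (a i))
          ((LinearMap.lTensor (A α) (d β)) ((Δ α β (α * β) rfl) (b i)))) = 0)
    (hrcov : ∀ (α β : G) (n : ℕ) (a b : Fin n → A (α * β)),
      (∑ i, sl (α * β) (a i) (d (α * β) (b i))) = 0 →
      (∑ i, tact (sl α) (LinearMap.mul k (A β)) ((Δ α β (α * β) rfl) (a i))
          ((LinearMap.rTensor (A β) (d α)) ((Δ α β (α * β) rfl) (b i)))) = 0)
    (Dl : ∀ α β γ : G, α * β = γ → (Γ γ →ₗ[k] A α ⊗[k] Γ β))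
    (Dr : ∀ α β γ : G, α * β = γ → (Γ γ →ₗ[k] Γ α ⊗[k] A β))
    (hDl : ∀ (α β γ : G) (h : α * β = γ) (a b : A γ),
      Dl α β γ h (sl γ a (d γ b))
        = tact (LinearMap.mul k (A α)) (sl β) ((Δ α β γ h) a)
            ((LinearMap.lTensor (A α) (d β)) ((Δ α β γ h) b)))
    (hDr : ∀ (α β γ : G) (h : α * β = γ) (a b : A γ),
      Dr α β γ h (sl γ a (d γ b))
        = tact (sl α) (LinearMap.mul k (A β)) ((Δ α β γ h) a)
            ((LinearMap.rTensor (A β) (d α)) ((Δ α β γ h) b))) :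
    ∀ (α β γ : G) (ρ : Γ (α * β * γ)),
      (TensorProduct.assoc k (A α) (Γ β) (A γ))
          ((LinearMap.rTensor (A γ) (Dl α β (α * β) rfl))
            (Dr (α * β) γ (α * β * γ) rfl ρ))
        = (LinearMap.lTensor (A α) (Dr β γ (β * γ) rfl))
            (Dl α (β * γ) (α * β * γ) (mul_assoc α β γ).symm ρ) := by
  intro α β γ ρ
  induction hgen _ ρ using Submodule.span_induction with
  | mem x hx =>
    obtain ⟨a, b, rfl⟩ := hx
    rw [hDr, hDl,
      assoc_rTensor_tact (Δ α β (α * β) rfl) _ _ (sl β) (d β) _ (hDl α β (α * β) rfl),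
      lTensor_tact (Δ β γ (β * γ) rfl) _ _ (sl β) (d β) _ (hDr β γ (β * γ) rfl),
      hcoassoc, hcoassoc]
  | zero => simp only [map_zero]
  | add x y _ _ hx hy => simp only [map_add, hx, hy]
  | smul c x _ hx => simp only [map_smul, hx]
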